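/- arXiv:1605.01287 — 2 statements merged into one kernel-verified Lean document; each statement's English description precedes it below -/
import Mathlib

section
/- Fix a weight w=(w₁,w₂) with w₁ ≥ w₂ > 0 and w₁+w₂ = 1. Let x ∈ ℝ²∖ℚ² and let Σ_x = (u_i)_{i∈ℕ} be a w-best approximation sequence of x. Then for all i, j ∈ ℕ one has 2^{−1/w₂}·A(û_{i+j}, u_i) < A(x, u_i) < 2^{1/w₂}·r(u_{i+1}). -/
open Filter

/-- The `w`-weighted quasi-norm `‖(y₁,y₂)‖_w = max(|y₁|^{1/w₁}, |y₂|^{1/w₂})`. -/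
noncomputable def wnorm (w₁ w₂ : ℝ) (y : ℝ × ℝ) : ℝ :=
  max (|y.1| ^ (1 / w₁)) (|y.2| ^ (1 / w₂))

/-- `A(x, v) = ‖q·x − p‖_w` for `v = (p₁, p₂, q)`. -/
noncomputable def Afun (w₁ w₂ : ℝ) (x : ℝ × ℝ) (v : ℤ × ℤ × ℤ) : ℝ :=
  wnorm w₁ w₂ ((v.2.2 : ℝ) * x.1 - (v.1 : ℝ), (v.2.2 : ℝ) * x.2 - (v.2.1 : ℝ))

/-- `Q` is the set of triples `(p₁, p₂, q) ∈ ℤ² × ℕ` with `gcd(p₁, p₂, q) = 1`. -/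
def Qset : Set (ℤ × ℤ × ℤ) :=
  {v | 0 < v.2.2 ∧ Int.gcd (Int.gcd v.1 v.2.1) v.2.2 = 1}

/-- `û = p/q ∈ ℚ² ⊆ ℝ²` for `u = (p, q)`. -/
noncomputable def uhat (u : ℤ × ℤ × ℤ) : ℝ × ℝ :=
  ((u.1 : ℝ) / (u.2.2 : ℝ), (u.2.1 : ℝ) / (u.2.2 : ℝ))

/-- `(p, q) ∈ ℤ² × ℕ` is a `w`-best approximate of `x`: its weighted error beats
every vector of strictly smaller denominator, and is minimal among vectors with the
same denominator. -/
def IsBest (w₁ w₂ : ℝ) (x : ℝ × ℝ) (u : ℤ × ℤ × ℤ) : Prop :=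
  0 < u.2.2 ∧
  (∀ v : ℤ × ℤ × ℤ, 0 < v.2.2 → v.2.2 < u.2.2 →
    Afun w₁ w₂ x u < Afun w₁ w₂ x v) ∧
  (∀ p : ℤ × ℤ, Afun w₁ w₂ x u ≤ Afun w₁ w₂ x (p.1, p.2, u.2.2))

/-- `r(u)`: the minimal value of `A(û, v)` over `v ∈ Q` with `v ≠ u`. -/
noncomputable def rfun (w₁ w₂ : ℝ) (u : ℤ × ℤ × ℤ) : ℝ :=
  sInf {a : ℝ | ∃ v ∈ Qset, v ≠ u ∧ a = Afun w₁ w₂ (uhat u) v}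

/-- A `w`-best approximation sequence of `x`: a sequence of `w`-best approximates
of `x` in `Q` with `|u₀| > 1`, strictly increasing denominators, and no `w`-best
approximate of `x` with denominator strictly between two consecutive terms. -/
def IsBestSeq (w₁ w₂ : ℝ) (x : ℝ × ℝ) (u : ℕ → ℤ × ℤ × ℤ) : Prop :=
  (∀ i, u i ∈ Qset) ∧ (∀ i, IsBest w₁ w₂ x (u i)) ∧ 1 < (u 0).2.2 ∧
  (∀ i, (u i).2.2 < (u (i + 1)).2.2) ∧
  (∀ i, ∀ v : ℤ × ℤ × ℤ, IsBest w₁ w₂ x v →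
    ¬((u i).2.2 < v.2.2 ∧ v.2.2 < (u (i + 1)).2.2))

/-- `x ∈ ℝ²` is rational, i.e. `x ∈ ℚ²`. -/
def IsRat (x : ℝ × ℝ) : Prop := ∃ a b : ℚ, x = ((a : ℝ), (b : ℝ))

theorem wnorm_nonneg (w₁ w₂ : ℝ) (y : ℝ × ℝ) : 0 ≤ wnorm w₁ w₂ y :=
  le_max_of_le_left (by positivity)

theorem rpow_one_div_lt {w w₂ a b : ℝ} (hw₂ : 0 < w₂) (hw : w₂ ≤ w) (ha : 0 ≤ a)
    (hab : a < 2 * b) : a ^ (1 / w) < (2 : ℝ) ^ (1 / w₂) * b ^ (1 / w) := by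
  have hw0 : 0 < w := hw₂.trans_le hw
  have hb : 0 ≤ b := by linarith
  calc a ^ (1 / w) < (2 * b) ^ (1 / w) := Real.rpow_lt_rpow ha hab (by positivity)
    _ = (2 : ℝ) ^ (1 / w) * b ^ (1 / w) := Real.mul_rpow (by norm_num) hb
    _ ≤ _ := by
      gcongr
      norm_num

theorem rpow_rpow_one_div {a w : ℝ} (ha : 0 ≤ a) (hw : 0 < w) : (a ^ w) ^ (1 / w) = a := by
  rw [← Real.rpow_mul ha, mul_one_div_cancel hw.ne', Real.rpow_one]

theorem le_rpow_of_rpow_one_div_le {a t w : ℝ} (ha : 0 ≤ a) (hw : 0 < w)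
    (h : a ^ (1 / w) ≤ t) : a ≤ t ^ w := by
  have := Real.rpow_le_rpow (by positivity) h hw.le
  rwa [← Real.rpow_mul ha, one_div_mul_cancel hw.ne', Real.rpow_one] at this

theorem abs_fst_le_wnorm_rpow {w₁ : ℝ} (w₂ : ℝ) (hw₁ : 0 < w₁) (y : ℝ × ℝ) :
    |y.1| ≤ wnorm w₁ w₂ y ^ w₁ :=
  le_rpow_of_rpow_one_div_le (abs_nonneg _) hw₁ (le_max_left _ _)

theorem abs_snd_le_wnorm_rpow (w₁ : ℝ) {w₂ : ℝ} (hw₂ : 0 < w₂) (y : ℝ × ℝ) :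
    |y.2| ≤ wnorm w₁ w₂ y ^ w₂ :=
  le_rpow_of_rpow_one_div_le (abs_nonneg _) hw₂ (le_max_right _ _)

theorem rpow_le_abs_of_le_wnorm {w₁ w₂ t : ℝ} (hw₁ : 0 < w₁) (hw₂ : 0 < w₂) (ht : 0 ≤ t)
    {y : ℝ × ℝ} (h : t ≤ wnorm w₁ w₂ y) : t ^ w₁ ≤ |y.1| ∨ t ^ w₂ ≤ |y.2| := by
  rcases le_max_iff.1 h with h | h
  · left
    have := Real.rpow_le_rpow ht h hw₁.le
    rwa [← Real.rpow_mul (abs_nonneg _), one_div_mul_cancel hw₁.ne', Real.rpow_one] at this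
  · right
    have := Real.rpow_le_rpow ht h hw₂.le
    rwa [← Real.rpow_mul (abs_nonneg _), one_div_mul_cancel hw₂.ne', Real.rpow_one] at this

theorem wnorm_mono {w₁ w₂ : ℝ} (hw₁ : 0 < w₁) (hw₂ : 0 < w₂) {y z : ℝ × ℝ}
    (h₁ : |y.1| ≤ |z.1|) (h₂ : |y.2| ≤ |z.2|) : wnorm w₁ w₂ y ≤ wnorm w₁ w₂ z :=
  max_le_max (Real.rpow_le_rpow (abs_nonneg _) h₁ (by positivity))
    (Real.rpow_le_rpow (abs_nonneg _) h₂ (by positivity))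

theorem wnorm_neg (w₁ w₂ : ℝ) (y : ℝ × ℝ) : wnorm w₁ w₂ (-y) = wnorm w₁ w₂ y := by
  simp [wnorm]

theorem Afun_neg (w₁ w₂ : ℝ) (x : ℝ × ℝ) (v : ℤ × ℤ × ℤ) :
    Afun w₁ w₂ x (-v) = Afun w₁ w₂ x v := by
  rw [Afun, ← wnorm_neg, Afun]
  congr 1
  ext <;> simp <;> ring

theorem Afun_round_le {w₁ w₂ : ℝ} (hw₁ : 0 < w₁) (hw₂ : 0 < w₂) (x : ℝ × ℝ)
    (v : ℤ × ℤ × ℤ) :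
    Afun w₁ w₂ x (round (v.2.2 * x.1), round (v.2.2 * x.2), v.2.2) ≤ Afun w₁ w₂ x v :=
  wnorm_mono hw₁ hw₂ (round_le _ _) (round_le _ _)

theorem IsBest.Afun_le_one {w₁ w₂ : ℝ} (hw₁ : 0 < w₁) (hw₂ : 0 < w₂) {x : ℝ × ℝ}
    {v : ℤ × ℤ × ℤ} (hv : IsBest w₁ w₂ x v) : Afun w₁ w₂ x v ≤ 1 := by
  have key (y : ℝ) : |y - round y| ≤ 1 := (abs_sub_round y).trans (by norm_num)
  refine (hv.2.2 (round (v.2.2 * x.1), round (v.2.2 * x.2))).trans (max_le ?_ ?_)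
  · exact Real.rpow_le_one (abs_nonneg _) (key _) (by positivity)
  · exact Real.rpow_le_one (abs_nonneg _) (key _) (by positivity)

/-- If no best approximate has denominator strictly between those of `u` and `u'`, then the
error of `u` is minimal among all denominators smaller than that of `u'`. -/
theorem IsBest.Afun_le_of_lt {w₁ w₂ : ℝ} (hw₁ : 0 < w₁) (hw₂ : 0 < w₂) {x : ℝ × ℝ}
    {u u' : ℤ × ℤ × ℤ} (hu : IsBest w₁ w₂ x u)
    (hgap : ∀ v, IsBest w₁ w₂ x v → ¬(u.2.2 < v.2.2 ∧ v.2.2 < u'.2.2)) (v : ℤ × ℤ × ℤ)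
    (hv : 0 < v.2.2) (hvu : v.2.2 < u'.2.2) : Afun w₁ w₂ x u ≤ Afun w₁ w₂ x v := by
  induction hn : v.2.2.toNat using Nat.strong_induction_on generalizing v with
  | _ n ih =>
    by_contra! hlt
    have hround := Afun_round_le hw₁ hw₂ x v
    refine hgap (round (v.2.2 * x.1), round (v.2.2 * x.2), v.2.2)
      ⟨hv, fun v' h0 h1 => (hround.trans_lt hlt).trans_le ?_, fun p => ?_⟩ ⟨?_, hvu⟩
    · exact ih v'.2.2.toNat (by simp only at h1; omega) v' h0 (h1.trans hvu) rfl
    · exact Afun_round_le hw₁ hw₂ x (p.1, p.2, v.2.2)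
    · by_contra! hle
      rcases hle.lt_or_eq with h | h
      · exact (hu.2.1 v hv h).not_gt hlt
      · refine (hu.2.2 (v.1, v.2.1)).not_gt ?_
        simp only at h
        rwa [← h]

/-- The only integer multiple of `u ∈ Q` that lies in `Q` is `u`. -/
theorem eq_of_mem_Qset_of_eq_mul {u v : ℤ × ℤ × ℤ} (hu : u ∈ Qset) (hv : v ∈ Qset) {m : ℤ}
    (h₁ : v.1 = m * u.1) (h₂ : v.2.1 = m * u.2.1) (h₃ : v.2.2 = m * u.2.2) : v = u := by
  have hdvd : m ∣ (Int.gcd (Int.gcd v.1 v.2.1) v.2.2 : ℤ) :=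
    Int.dvd_coe_gcd (Int.dvd_coe_gcd ⟨_, h₁⟩ ⟨_, h₂⟩) ⟨_, h₃⟩
  rw [hv.2] at hdvd
  have hm : 0 < m := pos_of_mul_pos_left (h₃ ▸ hv.1) hu.1.le
  have : m = 1 := le_antisymm (Int.le_of_dvd one_pos hdvd) hm
  subst this
  ext <;> simp [h₁, h₂, h₃]

theorem exists_two_mul_abs_sub_mul_le (b : ℤ) {q : ℤ} (hq : 0 < q) :
    ∃ m : ℤ, 2 * |b - m * q| ≤ q := by
  refine ⟨(2 * b + q) / (2 * q), ?_⟩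
  have h₁ := Int.emod_nonneg (2 * b + q) (by omega : 2 * q ≠ 0)
  have h₂ := Int.emod_lt_of_pos (2 * b + q) (by omega : 0 < 2 * q)
  have h₃ := Int.emod_add_mul_ediv (2 * b + q) (2 * q)
  rcases abs_cases (b - (2 * b + q) / (2 * q) * q) with ⟨h, -⟩ | ⟨h, -⟩ <;> rw [h] <;> linarith

/-- Replacing the point `x` by `p / q` moves the linear form `c x - a` by at most
`(c / q) |q x - p|`. -/
theorem abs_mul_sub_sub_le {x p q c a κ E : ℝ} (hq : 0 < q) (hc : |c| ≤ κ * q)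
    (hκ : 0 ≤ κ) (hE : |q * x - p| ≤ E) :
    |(c * (p / q) - a) - (c * x - a)| ≤ κ * E := by
  have : (c * (p / q) - a) - (c * x - a) = -(c / q * (q * x - p)) := by
    field_simp
    ring
  rw [this, abs_neg, abs_mul, abs_div, abs_of_pos hq]
  exact mul_le_mul ((div_le_iff₀ hq).2 hc) hE (abs_nonneg _) hκ

theorem Afun_uhat_lt {w₁ w₂ : ℝ} (hw₂ : 0 < w₂) (hw : w₂ ≤ w₁) {x : ℝ × ℝ}
    {u u' : ℤ × ℤ × ℤ} (hu : 0 < u.2.2) (hlt : u.2.2 < u'.2.2)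
    (hA : Afun w₁ w₂ x u' < Afun w₁ w₂ x u) :
    Afun w₁ w₂ (uhat u') u < (2 : ℝ) ^ (1 / w₂) * Afun w₁ w₂ x u := by
  have hw₁ : 0 < w₁ := hw₂.trans_le hw
  have hA' : 0 ≤ Afun w₁ w₂ x u' := wnorm_nonneg _ _ _
  have hA0 : 0 ≤ Afun w₁ w₂ x u := wnorm_nonneg _ _ _
  have hq : (0 : ℝ) < u'.2.2 := by exact_mod_cast hu.trans hlt
  have hc : |(u.2.2 : ℝ)| ≤ 1 * u'.2.2 := by
    rw [one_mul, abs_of_pos (by exact_mod_cast hu)]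
    exact_mod_cast hlt.le
  refine max_lt ?_ ?_
  · rw [← rpow_rpow_one_div hA0 hw₁]
    refine rpow_one_div_lt hw₂ hw (abs_nonneg _) ?_
    have h₁ := abs_mul_sub_sub_le (a := u.1) hq hc zero_le_one
      (abs_fst_le_wnorm_rpow w₂ hw₁ (u'.2.2 * x.1 - u'.1, u'.2.2 * x.2 - u'.2.1))
    have h₂ := abs_fst_le_wnorm_rpow w₂ hw₁ (u.2.2 * x.1 - u.1, u.2.2 * x.2 - u.2.1)
    have h₃ := Real.rpow_lt_rpow hA' hA hw₁
    simp only [Afun, uhat] at *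
    linarith [abs_sub_abs_le_abs_sub ((u.2.2 : ℝ) * (u'.1 / u'.2.2) - u.1) (u.2.2 * x.1 - u.1)]
  · rw [← rpow_rpow_one_div hA0 hw₂]
    refine rpow_one_div_lt hw₂ le_rfl (abs_nonneg _) ?_
    have h₁ := abs_mul_sub_sub_le (a := u.2.1) hq hc zero_le_one
      (abs_snd_le_wnorm_rpow w₁ hw₂ (u'.2.2 * x.1 - u'.1, u'.2.2 * x.2 - u'.2.1))
    have h₂ := abs_snd_le_wnorm_rpow w₁ hw₂ (u.2.2 * x.1 - u.1, u.2.2 * x.2 - u.2.1)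
    have h₃ := Real.rpow_lt_rpow hA' hA hw₂
    simp only [Afun, uhat] at *
    linarith [abs_sub_abs_le_abs_sub ((u.2.2 : ℝ) * (u'.2.1 / u'.2.2) - u.2.1)
      (u.2.2 * x.2 - u.2.1)]

theorem one_le_wnorm_intCast {w₁ w₂ : ℝ} (hw₁ : 0 < w₁) (hw₂ : 0 < w₂) {a b : ℤ}
    (h : a ≠ 0 ∨ b ≠ 0) : 1 ≤ wnorm w₁ w₂ (a, b) := by
  rcases h with h | h
  · refine le_max_of_le_left (Real.one_le_rpow ?_ (by positivity))
    change (1 : ℝ) ≤ |(a : ℝ)|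
    exact_mod_cast Int.one_le_abs h
  · refine le_max_of_le_right (Real.one_le_rpow ?_ (by positivity))
    change (1 : ℝ) ≤ |(b : ℝ)|
    exact_mod_cast Int.one_le_abs h

theorem Afun_uhat_sub_smul (w₁ w₂ : ℝ) {u : ℤ × ℤ × ℤ} (hu : 0 < u.2.2) (v : ℤ × ℤ × ℤ)
    (m : ℤ) : Afun w₁ w₂ (uhat u) (v - m • u) = Afun w₁ w₂ (uhat u) v := by
  have hq : (u.2.2 : ℝ) ≠ 0 := by exact_mod_cast hu.ne'
  simp only [Afun, uhat]
  congr 1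
  ext <;> simp <;> field_simp <;> ring

/-- If `x` has error at least `t` at `v`, then `û` has error at `v` bounded below in terms
of `t` and the error of `u`, provided the denominator of `v` is at most half that of `u`. -/
theorem min_le_Afun_uhat {w₁ w₂ t : ℝ} (hw₁ : 0 < w₁) (hw₂ : 0 < w₂) {x : ℝ × ℝ}
    {u v : ℤ × ℤ × ℤ} (hu : 0 < u.2.2) (hvu : 2 * |v.2.2| ≤ u.2.2)
    (hut : Afun w₁ w₂ x u ≤ t) (hvt : t ≤ Afun w₁ w₂ x v) :
    min ((t ^ w₁ - Afun w₁ w₂ x u ^ w₁ / 2) ^ (1 / w₁))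
      ((t ^ w₂ - Afun w₁ w₂ x u ^ w₂ / 2) ^ (1 / w₂)) ≤ Afun w₁ w₂ (uhat u) v := by
  have hA : 0 ≤ Afun w₁ w₂ x u := wnorm_nonneg _ _ _
  have hq : (0 : ℝ) < u.2.2 := by exact_mod_cast hu
  have hc : |(v.2.2 : ℝ)| ≤ 1 / 2 * u.2.2 := by
    have : 2 * |(v.2.2 : ℝ)| ≤ u.2.2 := by exact_mod_cast hvu
    linarith
  have hbase {w : ℝ} (hw : 0 < w) : 0 ≤ t ^ w - Afun w₁ w₂ x u ^ w / 2 := by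
    have h₁ := Real.rpow_le_rpow hA hut hw.le
    have h₂ := Real.rpow_nonneg hA w
    linarith
  rcases rpow_le_abs_of_le_wnorm hw₁ hw₂ (hA.trans hut) hvt with h | h
  · refine min_le_of_left_le (le_max_of_le_left (Real.rpow_le_rpow (hbase hw₁) ?_ (by positivity)))
    have h₁ := abs_mul_sub_sub_le (a := v.1) hq hc (by norm_num)
      (abs_fst_le_wnorm_rpow w₂ hw₁ (u.2.2 * x.1 - u.1, u.2.2 * x.2 - u.2.1))
    rw [abs_sub_comm] at h₁
    simp only [Afun, uhat] at *
    linarith [abs_sub_abs_le_abs_sub (v.2.2 * x.1 - v.1) ((v.2.2 : ℝ) * (u.1 / u.2.2) - v.1)]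
  · refine min_le_of_right_le
      (le_max_of_le_right (Real.rpow_le_rpow (hbase hw₂) ?_ (by positivity)))
    have h₁ := abs_mul_sub_sub_le (a := v.2.1) hq hc (by norm_num)
      (abs_snd_le_wnorm_rpow w₁ hw₂ (u.2.2 * x.1 - u.1, u.2.2 * x.2 - u.2.1))
    rw [abs_sub_comm] at h₁
    simp only [Afun, uhat] at *
    linarith [abs_sub_abs_le_abs_sub (v.2.2 * x.2 - v.2.1)
      ((v.2.2 : ℝ) * (u.2.1 / u.2.2) - v.2.1)]

theorem lt_two_rpow_mul_rfun {w₁ w₂ t : ℝ} (hw₂ : 0 < w₂) (hw : w₂ ≤ w₁) {x : ℝ × ℝ}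
    {u : ℤ × ℤ × ℤ} (hu : u ∈ Qset) (hu₁ : 1 < u.2.2) (hut : Afun w₁ w₂ x u < t) (ht : t ≤ 1)
    (hmin : ∀ v : ℤ × ℤ × ℤ, 0 < v.2.2 → v.2.2 < u.2.2 → t ≤ Afun w₁ w₂ x v) :
    t < (2 : ℝ) ^ (1 / w₂) * rfun w₁ w₂ u := by
  have hw₁ : 0 < w₁ := hw₂.trans_le hw
  have hA : 0 ≤ Afun w₁ w₂ x u := wnorm_nonneg _ _ _
  have ht0 : 0 ≤ t := hA.trans hut.le
  have hbound {w : ℝ} (hw₂w : w₂ ≤ w) :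
      t < (2 : ℝ) ^ (1 / w₂) * (t ^ w - Afun w₁ w₂ x u ^ w / 2) ^ (1 / w) := by
    have hw0 := hw₂.trans_le hw₂w
    have := Real.rpow_lt_rpow hA hut hw0
    simpa only [rpow_rpow_one_div ht0 hw0] using
      rpow_one_div_lt hw₂ hw₂w (Real.rpow_nonneg ht0 w)
        (b := t ^ w - Afun w₁ w₂ x u ^ w / 2) (by linarith)
  have hone : t < (2 : ℝ) ^ (1 / w₂) * 1 := by
    rw [mul_one]
    exact ht.trans_lt (Real.one_lt_rpow one_lt_two (by positivity))
  set δ := min 1 (min ((t ^ w₁ - Afun w₁ w₂ x u ^ w₁ / 2) ^ (1 / w₁))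
    ((t ^ w₂ - Afun w₁ w₂ x u ^ w₂ / 2) ^ (1 / w₂))) with hδ
  have hlt : t < (2 : ℝ) ^ (1 / w₂) * δ := by
    rw [hδ, mul_min_of_nonneg _ _ (by positivity), mul_min_of_nonneg _ _ (by positivity)]
    exact lt_min hone (lt_min (hbound hw) (hbound le_rfl))
  refine hlt.trans_le (mul_le_mul_of_nonneg_left (le_csInf ?_ ?_) (by positivity))
  · refine ⟨_, (0, 0, 1), ⟨one_pos, by simp⟩, fun h => ?_, rfl⟩
    simp [← h] at hu₁
  rintro _ ⟨v, hv, hvu, rfl⟩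
  obtain ⟨m, hm⟩ := exists_two_mul_abs_sub_mul_le v.2.2 hu.1
  rw [← Afun_uhat_sub_smul w₁ w₂ hu.1 v m]
  rcases lt_trichotomy (v.2.2 - m * u.2.2) 0 with hneg | hzero | hpos
  · refine (min_le_right _ _).trans (min_le_Afun_uhat hw₁ hw₂ hu.1 hm hut.le ?_)
    rw [← Afun_neg]
    rw [abs_of_neg hneg] at hm
    refine hmin _ ?_ ?_ <;> simp <;> linarith
  · refine (min_le_left _ _).trans ?_
    have hne : v.1 - m * u.1 ≠ 0 ∨ v.2.1 - m * u.2.1 ≠ 0 := by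
      by_contra! h
      exact hvu (eq_of_mem_Qset_of_eq_mul hu hv (sub_eq_zero.1 h.1) (sub_eq_zero.1 h.2)
        (sub_eq_zero.1 hzero))
    have hzero' : (v - m • u).2.2 = 0 := hzero
    rw [Afun, hzero', ← wnorm_neg]
    refine (one_le_wnorm_intCast hw₁ hw₂ hne).trans_eq (congrArg _ ?_)
    ext <;> simp
  · refine (min_le_right _ _).trans (min_le_Afun_uhat hw₁ hw₂ hu.1 hm hut.le ?_)
    rw [abs_of_pos hpos] at hm
    refine hmin _ ?_ ?_ <;> simp <;> linarith

/-- For `x ∈ ℝ² ∖ ℚ²` with best approximation sequence `(uᵢ)`, one has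
`2^{-1/w₂}·A(û_{i+j}, uᵢ) < A(x, uᵢ) < 2^{1/w₂}·r(u_{i+1})` for all `i` and `j ≥ 1`. -/
theorem best_seq_bounds (w₁ w₂ : ℝ) (hw₂ : 0 < w₂) (hw : w₂ ≤ w₁)
    (hsum : w₁ + w₂ = 1) (x : ℝ × ℝ) (hx : ¬IsRat x)
    (u : ℕ → ℤ × ℤ × ℤ) (hu : IsBestSeq w₁ w₂ x u) (i j : ℕ) (hj : 1 ≤ j) :
    (2 : ℝ) ^ (-(1 / w₂)) * Afun w₁ w₂ (uhat (u (i + j))) (u i) <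
        Afun w₁ w₂ x (u i) ∧
      Afun w₁ w₂ x (u i) < (2 : ℝ) ^ (1 / w₂) * rfun w₁ w₂ (u (i + 1)) := by
  obtain ⟨hQ, hbest, hone, hstep, hgap⟩ := hu
  have hw₁ : 0 < w₁ := hw₂.trans_le hw
  have hmono : StrictMono fun k => (u k).2.2 := strictMono_nat_of_lt_succ hstep
  have hA {k l : ℕ} (hkl : k < l) : Afun w₁ w₂ x (u l) < Afun w₁ w₂ x (u k) :=
    (hbest l).2.1 _ (hbest k).1 (hmono hkl)
  constructor
  · have hij : i < i + j := by omega
    rw [Real.rpow_neg zero_le_two, inv_mul_lt_iff₀ (by positivity)]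
    exact Afun_uhat_lt hw₂ hw (hbest i).1 (hmono hij) (hA hij)
  · exact lt_two_rpow_mul_rfun hw₂ hw (hQ _) (hone.trans (hmono i.succ_pos))
      (hA i.lt_succ_self) ((hbest i).Afun_le_one hw₁ hw₂)
      ((hbest i).Afun_le_of_lt hw₁ hw₂ (hgap i))
end

section
/- Fix a weight w=(w₁,w₂) with w₁ ≥ w₂ > 0 and w₁+w₂ = 1. There exists a constant C > 0 depending only on w such that the following holds for all 0 < ε < 1. Let u ∈ Q_ε, let u' ∈ Q satisfy |u'| ≤ |u|/2 and A(û, u') = r(u) (such u' exists), let H_u ⊆ ℝ³ be the real linear span of {u, u'}, and let D(u,ε) = {v ∈ Q_ε : v ∈ H_u, |v| ≥ |u|, A(v̂, u) < 2^{2/w₂}·r(u)}. Then for every real t with 2 < t ≤ 3 one has ∑_{v ∈ D(u,ε)} (|u|/|v|)^t ≤ C/(t−2). -/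
open Filter

/-- `Q_ε`: the set of `u ∈ Q` with `r(u)·|u| < ε` and `|u| > 1`. -/
def Qeps (w₁ w₂ ε : ℝ) : Set (ℤ × ℤ × ℤ) :=
  {u ∈ Qset | rfun w₁ w₂ u * (u.2.2 : ℝ) < ε ∧ 1 < u.2.2}

/-- The natural embedding of an integer triple in `ℝ³`. -/
def toR3 (v : ℤ × ℤ × ℤ) : ℝ × ℝ × ℝ := ((v.1 : ℝ), (v.2.1 : ℝ), (v.2.2 : ℝ))

theorem wnorm_pos {w₁ w₂ : ℝ} {y : ℝ × ℝ} (hy : y ≠ 0) : 0 < wnorm w₁ w₂ y := by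
  by_cases h : y.1 = 0
  · have h2 : y.2 ≠ 0 := fun h2 => hy (Prod.ext h h2)
    exact lt_max_of_lt_right (Real.rpow_pos_of_pos (abs_pos.2 h2) _)
  · exact lt_max_of_lt_left (Real.rpow_pos_of_pos (abs_pos.2 h) _)

theorem wnorm_smul (w₁ w₂ c : ℝ) (y : ℝ × ℝ) :
    wnorm w₁ w₂ (c • y) =
      max (|c| ^ (1 / w₁) * |y.1| ^ (1 / w₁)) (|c| ^ (1 / w₂) * |y.2| ^ (1 / w₂)) := by
  simp only [wnorm, Prod.smul_fst, Prod.smul_snd, smul_eq_mul, abs_mul]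
  rw [Real.mul_rpow (abs_nonneg _) (abs_nonneg _), Real.mul_rpow (abs_nonneg _) (abs_nonneg _)]

theorem wnorm_smul_lt {w₁ w₂ c : ℝ} {y : ℝ × ℝ} (hw₁ : 0 < w₁) (hw₂ : 0 < w₂) (hy : y ≠ 0)
    (hc : |c| < 1) : wnorm w₁ w₂ (c • y) < wnorm w₁ w₂ y := by
  have key : ∀ w : ℝ, 0 < w → ∀ x : ℝ, |x| ^ (1 / w) ≤ wnorm w₁ w₂ y →
      |c| ^ (1 / w) * |x| ^ (1 / w) < wnorm w₁ w₂ y := by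
    intro w hw x hx
    have h1 : |c| ^ (1 / w) < 1 := Real.rpow_lt_one (abs_nonneg _) hc (by positivity)
    calc |c| ^ (1 / w) * |x| ^ (1 / w) ≤ |c| ^ (1 / w) * wnorm w₁ w₂ y := by gcongr
      _ < 1 * wnorm w₁ w₂ y := mul_lt_mul_of_pos_right h1 (wnorm_pos hy)
      _ = _ := one_mul _
  rw [wnorm_smul]
  exact max_lt (key w₁ hw₁ _ (le_max_left _ _)) (key w₂ hw₂ _ (le_max_right _ _))

theorem rpow_mul_wnorm_le_wnorm_smul {w₁ w₂ c : ℝ} {y : ℝ × ℝ} (hw₂ : 0 < w₂) (hw : w₂ ≤ w₁)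
    (hc : 1 ≤ |c|) : |c| ^ (1 / w₁) * wnorm w₁ w₂ y ≤ wnorm w₁ w₂ (c • y) := by
  have h : |c| ^ (1 / w₁) ≤ |c| ^ (1 / w₂) :=
    Real.rpow_le_rpow_of_exponent_le hc (one_div_le_one_div_of_le hw₂ hw)
  rw [wnorm_smul, wnorm, mul_max_of_nonneg _ _ (by positivity)]
  gcongr

theorem abs_lt_of_wnorm_smul_lt {w₁ w₂ c : ℝ} {y : ℝ × ℝ} (hw₂ : 0 < w₂) (hw : w₂ ≤ w₁)
    (h : wnorm w₁ w₂ (c • y) < (2 : ℝ) ^ (2 / w₂) * wnorm w₁ w₂ y) :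
    |c| < (2 : ℝ) ^ (2 * w₁ / w₂) := by
  have hw₁ : 0 < w₁ := hw₂.trans_le hw
  have hK : (1 : ℝ) ≤ 2 ^ (2 * w₁ / w₂) := Real.one_le_rpow (by norm_num) (by positivity)
  rcases lt_or_ge |c| 1 with hc | hc
  · exact hc.trans_le hK
  · have h1 : |c| ^ (1 / w₁) < (2 : ℝ) ^ (2 / w₂) :=
      lt_of_mul_lt_mul_right ((rpow_mul_wnorm_le_wnorm_smul hw₂ hw hc).trans_lt h)
        (wnorm_nonneg _ _ _)
    have h2 := Real.rpow_lt_rpow (by positivity) h1 hw₁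
    rw [← Real.rpow_mul (abs_nonneg _), ← Real.rpow_mul (by norm_num), one_div,
      inv_mul_cancel₀ hw₁.ne', Real.rpow_one] at h2
    rwa [mul_div_right_comm]

/-- The planar part of the cross product of two integer triples. -/
def crossPair (u v : ℤ × ℤ × ℤ) : ℝ × ℝ :=
  ((v.2.2 : ℝ) * u.1 - u.2.2 * v.1, (v.2.2 : ℝ) * u.2.1 - u.2.2 * v.2.1)

theorem Afun_uhat {w₁ w₂ : ℝ} {u : ℤ × ℤ × ℤ} (hu : 0 < u.2.2) (v : ℤ × ℤ × ℤ) :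
    Afun w₁ w₂ (uhat u) v = wnorm w₁ w₂ ((u.2.2 : ℝ)⁻¹ • crossPair u v) := by
  have hu' : (u.2.2 : ℝ) ≠ 0 := by exact_mod_cast hu.ne'
  unfold Afun uhat crossPair
  congr 1
  ext <;> simp <;> field_simp

theorem crossPair_swap (u v : ℤ × ℤ × ℤ) : crossPair v u = -crossPair u v := by
  ext <;> simp [crossPair]

theorem crossPair_self (u : ℤ × ℤ × ℤ) : crossPair u u = 0 := by
  ext <;> simp [crossPair]

theorem crossPair_eq_smul {u u' v : ℤ × ℤ × ℤ} {a b : ℝ}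
    (h : a • toR3 u + b • toR3 u' = toR3 v) : crossPair u v = b • crossPair u u' := by
  simp only [toR3, Prod.ext_iff, Prod.fst_add, Prod.snd_add, Prod.smul_fst, Prod.smul_snd,
    smul_eq_mul] at h
  obtain ⟨h1, h2, h3⟩ := h
  ext
  · simp only [crossPair, Prod.smul_fst, smul_eq_mul]
    rw [← h1, ← h3]; ring
  · simp only [crossPair, Prod.smul_snd, smul_eq_mul]
    rw [← h2, ← h3]; ring

theorem exists_int_eq_of_smul_eq {u v : ℤ × ℤ × ℤ} (hu : u ∈ Qset) {a : ℝ}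
    (h : a • toR3 u = toR3 v) : ∃ m : ℤ, a = m := by
  simp only [toR3, Prod.ext_iff, Prod.smul_fst, Prod.smul_snd, smul_eq_mul] at h
  obtain ⟨h1, h2, h3⟩ := h
  have e1 := Int.gcd_eq_gcd_ab u.1 u.2.1
  have e2 := Int.gcd_eq_gcd_ab (Int.gcd u.1 u.2.1) u.2.2
  rw [hu.2] at e2
  have e3 := congrArg (Int.cast : ℤ → ℝ) e2
  have e4 := congrArg (Int.cast : ℤ → ℝ) e1
  push_cast at e3 e4
  refine ⟨(v.1 * Int.gcdA u.1 u.2.1 + v.2.1 * Int.gcdB u.1 u.2.1) *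
    Int.gcdA (Int.gcd u.1 u.2.1) u.2.2 + v.2.2 * Int.gcdB (Int.gcd u.1 u.2.1) u.2.2, ?_⟩
  push_cast
  rw [← h1, ← h2, ← h3]
  linear_combination a * e3 + a * (Int.gcdA (Int.gcd u.1 u.2.1) u.2.2 : ℝ) * e4

theorem eq_of_crossPair_eq_zero {u v : ℤ × ℤ × ℤ} (hu : u ∈ Qset) (hv : v ∈ Qset)
    (h : crossPair u v = 0) : u = v := by
  have hu0 : (0 : ℝ) < u.2.2 := by exact_mod_cast hu.1
  have hv0 : (0 : ℝ) < v.2.2 := by exact_mod_cast hv.1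
  simp only [crossPair, Prod.ext_iff, Prod.fst_zero, Prod.snd_zero] at h
  obtain ⟨h1, h2⟩ := h
  have e1 : ((v.2.2 : ℝ) / u.2.2) • toR3 u = toR3 v := by
    simp only [toR3, Prod.ext_iff, Prod.smul_fst, Prod.smul_snd, smul_eq_mul]
    refine ⟨?_, ?_, ?_⟩ <;> field_simp <;> linarith
  have e2 : ((u.2.2 : ℝ) / v.2.2) • toR3 v = toR3 u := by
    rw [← e1, smul_smul]
    rw [show (u.2.2 : ℝ) / v.2.2 * (v.2.2 / u.2.2) = 1 by field_simp, one_smul]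
  obtain ⟨m, hm⟩ := exists_int_eq_of_smul_eq hu e1
  obtain ⟨n, hn⟩ := exists_int_eq_of_smul_eq hv e2
  have hmn : m * n = 1 := by
    have : (m : ℝ) * n = 1 := by rw [← hm, ← hn]; field_simp
    exact_mod_cast this
  have hm0 : 0 ≤ m := by
    have : (0 : ℝ) ≤ m := by rw [← hm]; positivity
    exact_mod_cast this
  have hm1 : m = 1 := Int.eq_one_of_mul_eq_one_right hm0 hmn
  rw [hm, hm1, Int.cast_one, one_smul] at e1
  simpa [toR3, Prod.ext_iff] using e1

theorem rfun_le_Afun {w₁ w₂ : ℝ} {u v : ℤ × ℤ × ℤ} (hv : v ∈ Qset) (hvu : v ≠ u) :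
    rfun w₁ w₂ u ≤ Afun w₁ w₂ (uhat u) v :=
  csInf_le ⟨0, by rintro _ ⟨v, -, -, rfl⟩; exact wnorm_nonneg _ _ _⟩ ⟨v, hv, hvu, rfl⟩

/-- Every integer triple with positive last entry is a positive multiple of an element of `Q`. -/
theorem exists_Qset_smul_eq {v : ℤ × ℤ × ℤ} (hv : 0 < v.2.2) :
    ∃ g : ℤ, 0 < g ∧ ∃ z ∈ Qset, g • z = v := by
  have hg : 0 < Int.gcd (Int.gcd v.1 v.2.1) v.2.2 := Int.gcd_pos_of_ne_zero_right _ hv.ne'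
  set g := Int.gcd (Int.gcd v.1 v.2.1) v.2.2 with hgdef
  have d3 : (g : ℤ) ∣ v.2.2 := Int.gcd_dvd_right _ _
  have d12 : (g : ℤ) ∣ (Int.gcd v.1 v.2.1 : ℤ) := Int.gcd_dvd_left _ _
  obtain ⟨x, hx⟩ := d12.trans (Int.gcd_dvd_left _ _)
  obtain ⟨y, hy⟩ := d12.trans (Int.gcd_dvd_right _ _)
  obtain ⟨z, hz⟩ := d3
  have hg' : (0 : ℤ) < g := by exact_mod_cast hg
  refine ⟨g, hg', (x, y, z), ⟨?_, ?_⟩, ?_⟩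
  · rw [hz] at hv
    exact pos_of_mul_pos_right hv hg'.le
  · rw [hx, hy, hz, Int.gcd_mul_left, Nat.cast_mul, Int.natAbs_natCast, Int.gcd_mul_left,
      Int.natAbs_natCast] at hgdef
    exact (Nat.mul_eq_left hg.ne').1 hgdef.symm
  · ext <;> simp [hx, hy, hz]

theorem rfun_le_wnorm_crossPair {w₁ w₂ : ℝ} (hw₁ : 0 < w₁) (hw₂ : 0 < w₂) {u v : ℤ × ℤ × ℤ}
    (hu : 0 < u.2.2) (hv : 0 < v.2.2) (huv : crossPair u v ≠ 0) :
    rfun w₁ w₂ u ≤ wnorm w₁ w₂ ((u.2.2 : ℝ)⁻¹ • crossPair u v) := by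
  obtain ⟨g, hg, z, hz, hgz⟩ := exists_Qset_smul_eq hv
  have hc : crossPair u v = (g : ℝ) • crossPair u z := by
    refine crossPair_eq_smul (a := 0) ?_
    rw [← hgz]
    simp [toR3]
  have hcz : crossPair u z ≠ 0 := by
    intro h
    rw [h, smul_zero] at hc
    exact huv hc
  have hzu : z ≠ u := by
    rintro rfl
    exact hcz (crossPair_self z)
  refine (rfun_le_Afun hz hzu).trans ?_
  rw [Afun_uhat hu]
  rcases (show 1 ≤ g from hg).eq_or_lt with h1 | h1
  · rw [hc, ← h1]
    simp
  · have hg0 : (g : ℝ) ≠ 0 := by exact_mod_cast hg.ne'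
    have hu0 : (u.2.2 : ℝ) ≠ 0 := by exact_mod_cast hu.ne'
    have hgz' : (u.2.2 : ℝ)⁻¹ • crossPair u z =
        (g : ℝ)⁻¹ • ((u.2.2 : ℝ)⁻¹ • crossPair u v) := by
      rw [hc, smul_comm (g : ℝ)⁻¹, smul_smul (g : ℝ)⁻¹, inv_mul_cancel₀ hg0, one_smul]
    rw [hgz']
    refine (wnorm_smul_lt hw₁ hw₂ (smul_ne_zero (inv_ne_zero hu0) huv) ?_).le
    have h1' : (1 : ℝ) < g := by exact_mod_cast h1
    rw [abs_inv, abs_of_pos (by linarith)]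
    exact inv_lt_one_of_one_lt₀ h1'

/-- If `u'` realises `r(u)`, then integer points of the plane spanned by `u` and `u'` have
integral `u'`-coordinate. -/
theorem exists_int_coord {w₁ w₂ : ℝ} (hw₁ : 0 < w₁) (hw₂ : 0 < w₂) {u u' v : ℤ × ℤ × ℤ}
    (hu : 0 < u.2.2) (hc : crossPair u u' ≠ 0) (hr : Afun w₁ w₂ (uhat u) u' = rfun w₁ w₂ u)
    {a b : ℝ} (h : a • toR3 u + b • toR3 u' = toR3 v) : ∃ n : ℤ, b = n := by
  by_contra! hb
  have hf0 : Int.fract b ≠ 0 := fun h0 => hb ⌊b⌋ (by have := Int.floor_add_fract b; linarith)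
  obtain ⟨m, hm⟩ : ∃ m : ℤ, 0 < v.2.2 - ⌊b⌋ * u'.2.2 + m * u.2.2 := by
    refine ⟨1 + |v.2.2 - ⌊b⌋ * u'.2.2|, ?_⟩
    nlinarith [neg_abs_le (v.2.2 - ⌊b⌋ * u'.2.2), abs_nonneg (v.2.2 - ⌊b⌋ * u'.2.2)]
  have hz : (a + m) • toR3 u + Int.fract b • toR3 u' = toR3 (v - ⌊b⌋ • u' + m • u) := by
    have e : toR3 (v - ⌊b⌋ • u' + m • u) =
        toR3 v - (⌊b⌋ : ℝ) • toR3 u' + (m : ℝ) • toR3 u := by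
      simp [toR3]
    rw [e, ← h, Int.fract]
    module
  have hcz := crossPair_eq_smul hz
  have hlt := rfun_le_wnorm_crossPair hw₁ hw₂ (v := v - ⌊b⌋ • u' + m • u) hu (by simpa using hm)
    (by rw [hcz]; exact smul_ne_zero hf0 hc)
  rw [← hr, Afun_uhat hu, hcz, smul_comm] at hlt
  have hu0 : (u.2.2 : ℝ) ≠ 0 := by exact_mod_cast hu.ne'
  refine hlt.not_gt (wnorm_smul_lt hw₁ hw₂ (smul_ne_zero (inv_ne_zero hu0) hc) ?_)
  rw [abs_of_nonneg (Int.fract_nonneg b)]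
  exact Int.fract_lt_one b

theorem sub_one_mul_rpow_neg_le {x s : ℝ} (hx : 1 < x) (hs : 1 < s) :
    (s - 1) * x ^ (-s) ≤ (x - 1) ^ (1 - s) - x ^ (1 - s) := by
  have hx0 : 0 < x := by linarith
  have hy0 : 0 < (x - 1) / x := div_pos (by linarith) hx0
  have h1 : 1 + (s - 1) / x ≤ ((x - 1) / x) ^ (1 - s) := by
    rw [Real.rpow_def_of_pos hy0]
    have hl := Real.log_le_sub_one_of_pos hy0
    have hl' : (x - 1) / x - 1 = -(1 / x) := by field_simp; ring
    rw [hl'] at hl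
    have he := Real.add_one_le_exp (Real.log ((x - 1) / x) * (1 - s))
    have hd : (s - 1) / x = (s - 1) * (1 / x) := by ring
    rw [hd]
    nlinarith
  have h2 : (x - 1) ^ (1 - s) = ((x - 1) / x) ^ (1 - s) * x ^ (1 - s) := by
    rw [← Real.mul_rpow hy0.le hx0.le, div_mul_cancel₀ _ hx0.ne']
  have h3 : x ^ (-s) = x ^ (1 - s) / x := by
    rw [← Real.rpow_sub_one hx0.ne']
    congr 1
    ring
  have h4 := mul_le_mul_of_nonneg_right h1 (Real.rpow_nonneg hx0.le (1 - s))
  rw [h2, h3]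
  calc _ = (1 + (s - 1) / x) * x ^ (1 - s) - x ^ (1 - s) := by ring
    _ ≤ _ := by linarith

theorem sum_rpow_neg_le {s : ℝ} (hs : 1 < s) (n : ℕ) :
    ∑ k ∈ Finset.range (n + 1), ((k : ℝ) + 1) ^ (-s) ≤
      (s - ((n : ℝ) + 1) ^ (1 - s)) / (s - 1) := by
  have hs1 : 0 < s - 1 := by linarith
  induction n with
  | zero => simp [div_self hs1.ne']
  | succ n ih =>
    rw [Finset.sum_range_succ]
    have hn : (0 : ℝ) ≤ n := n.cast_nonneg
    have h := sub_one_mul_rpow_neg_le (x := (n : ℝ) + 1 + 1) (by linarith) hs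
    rw [add_sub_cancel_right] at h
    push_cast
    rw [le_div_iff₀ hs1] at ih ⊢
    linarith

theorem tsum_ofReal_rpow_neg_le {s : ℝ} (hs : 1 < s) :
    ∑' k : ℕ, ENNReal.ofReal (((k : ℝ) + 1) ^ (-s)) ≤ ENNReal.ofReal (s / (s - 1)) := by
  have hs1 : 0 < s - 1 := by linarith
  refine ENNReal.tsum_le_of_sum_range_le fun n => ?_
  refine (Finset.sum_le_sum_of_subset (Finset.range_subset_range.2 n.le_succ)).trans ?_
  rw [← ENNReal.ofReal_sum_of_nonneg fun k _ => by positivity]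
  refine ENNReal.ofReal_le_ofReal ((sum_rpow_neg_le hs n).trans ?_)
  gcongr
  have : (0 : ℝ) ≤ ((n : ℝ) + 1) ^ (1 - s) := by positivity
  linarith

/-- A sum over integer points of a planar cone, weighted by a power of the height. -/
theorem tsum_cone_le {t : ℝ} (ht : 2 < t) (ht3 : t ≤ 3) (N : ℕ) :
    ∑' p : ℕ × ℤ, (if |p.2| ≤ N * (p.1 + 1) then ENNReal.ofReal (((p.1 : ℝ) + 1) ^ (-t)) else 0) ≤
      ENNReal.ofReal ((2 * N + 1) * 2 / (t - 2)) := by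
  have inner : ∀ k : ℕ,
      ∑' b : ℤ, (if |b| ≤ N * (k + 1) then ENNReal.ofReal (((k : ℝ) + 1) ^ (-t)) else 0) ≤
        ENNReal.ofReal (2 * N + 1) * ENNReal.ofReal (((k : ℝ) + 1) ^ (-(t - 1))) := by
    intro k
    rw [tsum_eq_sum (s := Finset.Icc (-(N * (k + 1) : ℤ)) (N * (k + 1)))]
    · refine (Finset.sum_le_card_nsmul _ _ (ENNReal.ofReal (((k : ℝ) + 1) ^ (-t))) ?_).trans ?_
      · intro b _
        split_ifs
        · exact le_rfl
        · exact zero_le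
      · rw [nsmul_eq_mul, ← ENNReal.ofReal_natCast, ← ENNReal.ofReal_mul (by positivity),
          ← ENNReal.ofReal_mul (by positivity)]
        refine ENNReal.ofReal_le_ofReal ?_
        have hk : (0 : ℝ) < (k : ℝ) + 1 := by positivity
        have hp : ((k : ℝ) + 1) ^ (-(t - 1)) = ((k : ℝ) + 1) * ((k : ℝ) + 1) ^ (-t) := by
          rw [← Real.rpow_one_add' hk.le (by linarith)]
          congr 1
          ring
        rw [hp, ← mul_assoc]
        gcongr
        have hcard : (Finset.Icc (-(N * (k + 1) : ℤ)) (N * (k + 1))).card =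
            2 * (N * (k + 1)) + 1 := by
          rw [Int.card_Icc]
          have : (N * (k + 1) : ℤ) = ((N * (k + 1) : ℕ) : ℤ) := by push_cast; ring
          rw [this]
          omega
        rw [hcard]
        push_cast
        have : (0 : ℝ) ≤ k := k.cast_nonneg
        linarith
    · intro b hb
      rw [if_neg]
      rwa [Finset.mem_Icc, ← abs_le] at hb
  have h2 := tsum_ofReal_rpow_neg_le (s := t - 1) (by linarith)
  rw [ENNReal.tsum_prod (f := fun (k : ℕ) (b : ℤ) =>
    if |b| ≤ N * (k + 1) then ENNReal.ofReal (((k : ℝ) + 1) ^ (-t)) else 0)]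
  refine (ENNReal.tsum_le_tsum inner).trans ?_
  rw [ENNReal.tsum_mul_left]
  refine (mul_le_mul_right h2 _).trans ?_
  rw [← ENNReal.ofReal_mul (by positivity)]
  refine ENNReal.ofReal_le_ofReal ?_
  rw [← mul_div_assoc, show t - 1 - 1 = t - 2 by ring]
  have : 0 < t - 2 := by linarith
  gcongr
  linarith

/-- There is a constant `C > 0` depending only on the weight such that for all
`0 < ε < 1`, all `u ∈ Q_ε`, any `u' ∈ Q` with `|u'| ≤ |u|/2` and `A(û, u') = r(u)`
(`H_u` being the real span of `{u, u'}`), and all `2 < t ≤ 3`, one has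
`∑_{v ∈ D(u,ε)} (|u|/|v|)ᵗ ≤ C/(t−2)`, where
`D(u,ε) = {v ∈ Q_ε ∩ H_u : |v| ≥ |u|, A(v̂, u) < 2^{2/w₂}·r(u)}`. -/
theorem sum_over_D_le (w₁ w₂ : ℝ) (hw₂ : 0 < w₂) (hw : w₂ ≤ w₁)
    (hsum : w₁ + w₂ = 1) :
    ∃ C : ℝ, 0 < C ∧ ∀ ε : ℝ, 0 < ε → ε < 1 →
      ∀ u ∈ Qeps w₁ w₂ ε, ∀ u' ∈ Qset,
        (u'.2.2 : ℝ) ≤ (u.2.2 : ℝ) / 2 →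
        Afun w₁ w₂ (uhat u) u' = rfun w₁ w₂ u →
        ∀ t : ℝ, 2 < t → t ≤ 3 →
        ∑' v : {v : ℤ × ℤ × ℤ // v ∈ Qeps w₁ w₂ ε ∧
            toR3 v ∈ Submodule.span ℝ ({toR3 u, toR3 u'} : Set (ℝ × ℝ × ℝ)) ∧
            u.2.2 ≤ v.2.2 ∧
            Afun w₁ w₂ (uhat v) u < (2 : ℝ) ^ (2 / w₂) * rfun w₁ w₂ u},
          ENNReal.ofReal (((u.2.2 : ℝ) / ((v : ℤ × ℤ × ℤ).2.2 : ℝ)) ^ t) ≤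
        ENNReal.ofReal (C / (t - 2)) := by
  have hw₁ : 0 < w₁ := hw₂.trans_le hw
  set K : ℝ := (2 : ℝ) ^ (2 * w₁ / w₂)
  have hK0 : 0 < K := by positivity
  obtain ⟨N, hN⟩ := exists_nat_ge (2 * K)
  refine ⟨(2 * N + 1) * 2, by positivity, ?_⟩
  intro ε _ _ u hu u' hu' hq hr t ht ht3
  have hu0 : 0 < u.2.2 := hu.1.1
  have hu0' : (0 : ℝ) < u.2.2 := by exact_mod_cast hu0
  have hc : crossPair u u' ≠ 0 := by
    intro h
    rw [← eq_of_crossPair_eq_zero hu.1 hu' h] at hq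
    linarith
  have coords : ∀ v : {v : ℤ × ℤ × ℤ // v ∈ Qeps w₁ w₂ ε ∧
      toR3 v ∈ Submodule.span ℝ ({toR3 u, toR3 u'} : Set (ℝ × ℝ × ℝ)) ∧
      u.2.2 ≤ v.2.2 ∧ Afun w₁ w₂ (uhat v) u < (2 : ℝ) ^ (2 / w₂) * rfun w₁ w₂ u},
      ∃ b : ℤ, (∃ a : ℝ, a • toR3 u + (b : ℝ) • toR3 u' = toR3 v.1) ∧
        |(b : ℝ)| < K * (v.1.2.2 / u.2.2) := by
    rintro ⟨v, hv, hspan, huv, hA⟩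
    obtain ⟨a, b, hab⟩ := Submodule.mem_span_pair.1 hspan
    obtain ⟨n, rfl⟩ := exists_int_coord hw₁ hw₂ hu0 hc hr hab
    refine ⟨n, ⟨a, hab⟩, ?_⟩
    have hv0 : 0 < v.2.2 := hv.1.1
    have hv0' : (0 : ℝ) < v.2.2 := by exact_mod_cast hv0
    rw [← hr, Afun_uhat hv0, Afun_uhat hu0, crossPair_swap, crossPair_eq_smul hab] at hA
    have e : (v.2.2 : ℝ)⁻¹ • -((n : ℝ) • crossPair u u') =
        (-(n * (u.2.2 / v.2.2)) : ℝ) • ((u.2.2 : ℝ)⁻¹ • crossPair u u') := by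
      rw [← neg_smul, smul_smul, smul_smul]
      congr 1
      field_simp
    rw [e] at hA
    have hlt := abs_lt_of_wnorm_smul_lt hw₂ hw hA
    rw [abs_neg, abs_mul, abs_of_pos (show (0 : ℝ) < u.2.2 / v.2.2 by positivity)] at hlt
    calc |(n : ℝ)| = |(n : ℝ)| * (u.2.2 / v.2.2) * (v.2.2 / u.2.2) := by field_simp
      _ < K * (v.2.2 / u.2.2) := by gcongr
  choose b hb hbK using coords
  refine le_trans ?_ (tsum_cone_le ht ht3 N)
  have hinj : Function.Injective fun v => ((v.1.2.2 / u.2.2 - 1).toNat, b v) := by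
    intro v v' h
    obtain ⟨h1, h2⟩ := Prod.ext_iff.1 h
    dsimp only at h1 h2
    obtain ⟨a, ha⟩ := hb v
    obtain ⟨a', ha'⟩ := hb v'
    rw [h2] at ha
    have hd : (a - a') • toR3 u = toR3 (v.1 - v'.1) := by
      have e : toR3 (v.1 - v'.1) = toR3 v.1 - toR3 v'.1 := by simp [toR3]
      rw [e, ← ha, ← ha']
      module
    obtain ⟨m, hm⟩ := exists_int_eq_of_smul_eq hu.1 hd
    rw [hm] at hd
    have k1 : 1 ≤ v.1.2.2 / u.2.2 := (Int.le_ediv_iff_mul_le hu0).2 (by linarith [v.2.2.2.1])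
    have k2 : 1 ≤ v'.1.2.2 / u.2.2 := (Int.le_ediv_iff_mul_le hu0).2 (by linarith [v'.2.2.2.1])
    have hk : v.1.2.2 / u.2.2 = v'.1.2.2 / u.2.2 := by omega
    have hq3 : m * u.2.2 = v.1.2.2 - v'.1.2.2 := by
      have := congrArg (fun x : ℝ × ℝ × ℝ => x.2.2) hd
      simp only [toR3, Prod.smul_snd, smul_eq_mul, Prod.snd_sub] at this
      exact_mod_cast this
    have hm0 : m = 0 := by
      have e : v.1.2.2 = v'.1.2.2 + m * u.2.2 := by linarith
      rw [e, Int.add_mul_ediv_right _ _ hu0.ne'] at hk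
      linarith
    rw [hm0, Int.cast_zero, zero_smul] at hd
    refine Subtype.ext (sub_eq_zero.1 ?_)
    simp only [toR3, Prod.ext_iff, Prod.fst_zero, Prod.snd_zero] at hd
    obtain ⟨d1, d2, d3⟩ := hd
    ext
    · exact_mod_cast d1.symm
    · exact_mod_cast d2.symm
    · exact_mod_cast d3.symm
  refine le_trans (ENNReal.tsum_le_tsum fun v => ?_)
    (ENNReal.tsum_comp_le_tsum_of_injective hinj _)
  have hk1 : 1 ≤ v.1.2.2 / u.2.2 := (Int.le_ediv_iff_mul_le hu0).2 (by linarith [v.2.2.2.1])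
  obtain ⟨k, hk⟩ : ∃ k : ℕ, v.1.2.2 / u.2.2 = k + 1 := ⟨(v.1.2.2 / u.2.2 - 1).toNat, by omega⟩
  have hlow : (k + 1 : ℤ) * u.2.2 ≤ v.1.2.2 := hk ▸ Int.ediv_mul_le _ hu0.ne'
  have hupp : v.1.2.2 < (k + 1 + 1 : ℤ) * u.2.2 := hk ▸ Int.lt_ediv_add_one_mul_self _ hu0
  have hlow' : (k + 1 : ℝ) ≤ v.1.2.2 / u.2.2 := by
    rw [le_div_iff₀ hu0']
    exact_mod_cast hlow
  have hupp' : (v.1.2.2 / u.2.2 : ℝ) < k + 1 + 1 := by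
    rw [div_lt_iff₀ hu0']
    exact_mod_cast hupp
  have hkn : (0 : ℝ) ≤ k := k.cast_nonneg
  have hbN : |b v| ≤ N * (k + 1) := by
    have : |(b v : ℝ)| ≤ N * (k + 1) := calc
      |(b v : ℝ)| ≤ K * (v.1.2.2 / u.2.2) := (hbK v).le
      _ ≤ K * (2 * (k + 1)) := by gcongr; linarith
      _ = 2 * K * (k + 1) := by ring
      _ ≤ N * (k + 1) := by gcongr
    exact_mod_cast this
  simp only [hk, add_sub_cancel_right, Int.toNat_natCast, if_pos hbN]
  refine ENNReal.ofReal_le_ofReal ?_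
  rw [← inv_div, Real.inv_rpow (by linarith), Real.rpow_neg (by linarith)]
  gcongr
end
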